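/- arXiv:math/0608701 — 3 statements merged into one kernel-verified Lean document; each statement's English description precedes it below -/
import Mathlib

section
/- Let k ≥ 2 be even and let π be a k-cycle in S_k, so that the centralizer of π in S_k is the cyclic subgroup ⟨π⟩ of order k. Let ρ : ⟨π⟩ → ℂˣ be a group homomorphism with ρ(π) = -1. Then for all elements t, t' in the conjugacy class of π with t t' = t' t, and all g, g' ∈ S_k with g π g⁻¹ = t and g' π g'⁻¹ = t', the elements g'⁻¹ t g' and g⁻¹ t' g lie in ⟨π⟩, ρ(g⁻¹ t g) = -1, and ρ(g'⁻¹ t g') · ρ(g⁻¹ t' g) = 1. (In the paper's terminology, the braiding of the Yetter–Drinfeld module M(O_π, χ_{-1}) is negative.) -/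
open Equiv.Perm in
/-- A character of the cyclic group generated by an odd permutation `π` that maps `π` to `-1`
is the restriction of the sign. -/
theorem zpowers_character_eq_sign {α : Type*} [Fintype α] [DecidableEq α] {R : Type*} [Ring R]
    {π : Equiv.Perm α} (hsign : sign π = -1) (ρ : Subgroup.zpowers π →* Rˣ)
    (hρ : ρ ⟨π, Subgroup.mem_zpowers π⟩ = -1) (x : Equiv.Perm α)
    (hx : x ∈ Subgroup.zpowers π) :
    ρ ⟨x, hx⟩ = Units.map (Int.castRingHom R).toMonoidHom (sign x) := by
  obtain ⟨n, rfl⟩ := Subgroup.mem_zpowers_iff.mp hx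
  have hpow : (⟨π ^ n, hx⟩ : Subgroup.zpowers π) = ⟨π, Subgroup.mem_zpowers π⟩ ^ n := rfl
  have hneg : Units.map (Int.castRingHom R).toMonoidHom (-1) = -1 := by
    ext
    simp
  rw [hpow, map_zpow, hρ, map_zpow, hsign, map_zpow, hneg]

/-- If `g π g⁻¹` and `h π h⁻¹` commute, then `h⁻¹ (g π g⁻¹) h` centralizes `π`. -/
theorem conj_mem_centralizer_of_commute {G : Type*} [Group G] {π g h : G}
    (hcomm : Commute (g * π * g⁻¹) (h * π * h⁻¹)) :
    h⁻¹ * (g * π * g⁻¹) * h ∈ Subgroup.centralizer {π} := by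
  rw [Subgroup.mem_centralizer_singleton_iff]
  have := congrArg (fun y => h⁻¹ * y * h) hcomm.eq
  simpa [mul_assoc] using this


/-- Let `k ≥ 2` be even and let `π` be a `k`-cycle in `S_k` (on `Fin k`),
so that the centralizer of `π` in `S_k` is the cyclic subgroup `⟨π⟩` of order `k`.
Let `ρ : ⟨π⟩ → ℂˣ` be a group homomorphism with `ρ(π) = -1`.  Then for all elements
`t, t'` of the conjugacy class of `π` that commute, and all `g, g'` with
`g π g⁻¹ = t`, `g' π g'⁻¹ = t'`, the elements `g'⁻¹ t g'` and `g⁻¹ t' g` lie in `⟨π⟩`,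
`ρ(g⁻¹ t g) = -1`, and `ρ(g'⁻¹ t g') · ρ(g⁻¹ t' g) = 1`: the braiding of the
Yetter–Drinfeld module `M(O_π, χ_{-1})` is negative. -/
theorem stmt2 (k : ℕ) (hk : 2 ≤ k) (hkeven : Even k)
    (π : Equiv.Perm (Fin k)) (hcyc : π.IsCycle) (hsupp : π.support = Finset.univ)
    (hcent : Subgroup.centralizer {π} = Subgroup.zpowers π)
    (horder : orderOf π = k)
    (ρ : ↥(Subgroup.zpowers π) →* ℂˣ)
    (hρ : ∀ h : π ∈ Subgroup.zpowers π, ρ ⟨π, h⟩ = -1)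
    (t t' : Equiv.Perm (Fin k)) (hcomm : t * t' = t' * t)
    (g g' : Equiv.Perm (Fin k)) (hg : g * π * g⁻¹ = t) (hg' : g' * π * g'⁻¹ = t') :
    g'⁻¹ * t * g' ∈ Subgroup.zpowers π ∧
    g⁻¹ * t' * g ∈ Subgroup.zpowers π ∧
    (∀ h : g⁻¹ * t * g ∈ Subgroup.zpowers π, ρ ⟨g⁻¹ * t * g, h⟩ = -1) ∧
    (∀ (h1 : g'⁻¹ * t * g' ∈ Subgroup.zpowers π)
       (h2 : g⁻¹ * t' * g ∈ Subgroup.zpowers π),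
      ρ ⟨g'⁻¹ * t * g', h1⟩ * ρ ⟨g⁻¹ * t' * g, h2⟩ = 1) := by
  subst hg hg'
  have hsign : Equiv.Perm.sign π = -1 := by
    rw [hcyc.sign, hsupp, Finset.card_univ, Fintype.card_fin, hkeven.neg_one_pow]
  have hmem := conj_mem_centralizer_of_commute hcomm
  have hmem' := conj_mem_centralizer_of_commute (Commute.symm hcomm)
  rw [hcent] at hmem hmem'
  have hodd (x : Equiv.Perm (Fin k)) (hx : x ∈ Subgroup.zpowers π)
      (hs : Equiv.Perm.sign x = -1) : ρ ⟨x, hx⟩ = -1 := by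
    rw [zpowers_character_eq_sign hsign ρ (hρ _), hs]
    ext
    simp
  have hconj (a b : Equiv.Perm (Fin k)) :
      Equiv.Perm.sign (b⁻¹ * (a * π * a⁻¹) * b) = -1 := by
    simp [hsign, mul_comm]
  refine ⟨hmem, hmem', fun h => hodd _ h (hconj g g), fun h1 h2 => ?_⟩
  rw [hodd _ h1 (hconj g g'), hodd _ h2 (hconj g' g), neg_one_mul, neg_neg]
end

section
/- Let r ≥ 2 be even and let n ≥ 2 be even. In S_{2rn}, for 1 ≤ j ≤ n let A_j be the 2r-cycle (2r(j-1)+1, …, 2rj), let π = A_1⋯A_n, and for 1 ≤ i ≤ n-1 let B_i = ∏_{m=1}^{2r}(2r(i-1)+m, 2ri+m). Let g ∈ S_{2rn} be such that g π g⁻¹ commutes with π, and suppose g π g⁻¹ = A_1^{d_1}⋯A_n^{d_n}·B and g⁻¹ π g = A_1^{e_1}⋯A_n^{e_n}·B', where d_1,…,d_n, e_1,…,e_n are integers and B, B' lie in the subgroup generated by B_1,…,B_{n-1}. Then ∑_{j=1}^n (e_j + d_j) ≡ 0 (mod 4). -/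
section

open Finset

/-- Commuting permutations that agree at a point have powers that agree at that point. -/
theorem Commute.zpow_apply_eq_of_apply_eq {X : Type*} {f h : Equiv.Perm X} (hc : Commute f h)
    {x : X} (hx : f x = h x) (k : ℤ) : (f ^ k) x = (h ^ k) x := by
  have hfix : (h⁻¹ * f) x = x := by simp [hx]
  have := Equiv.Perm.zpow_apply_eq_self_of_apply_eq_self hfix k
  rwa [hc.symm.inv_left.mul_zpow, inv_zpow, Equiv.Perm.mul_apply, Equiv.Perm.inv_eq_iff_eq] at this

/-- If `u` and `v` are inverse to each other modulo `K` and `4 ∣ m * K`, then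
`m * (u + v) ≡ 2 * m` modulo `4`. -/
theorem four_dvd_of_mul_modEq_one {m K u v : ℤ} (h4 : 4 ∣ m * K) (hK : K ∣ u * v - 1) :
    4 ∣ m * u + m * v - 2 * m := by
  obtain ⟨a, ha⟩ := h4
  obtain ⟨b, hb⟩ := hK
  have key : ∀ m K u v b : ZMod 4, m * K = 0 → u * v - 1 = K * b →
      m * u + m * v - 2 * m = 0 := by decide
  have h := key m K u v b
    (by rw [← Int.cast_mul, ha, Int.cast_mul]; exact zero_mul _)
    (by rw [← Int.cast_mul, ← Int.cast_mul, ← hb]; push_cast; rfl)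
  exact (ZMod.intCast_zmod_eq_zero_iff_dvd _ 4).1 (by push_cast; exact h)

section Heights

variable {X : Type*} {N : ℕ} {π σ : Equiv.Perm X} {p q : X → ZMod N}

/-- If `π` raises the height `p` by one, then `π ^ k` raises it by `k`. -/
theorem height_zpow (hp : ∀ x, p (π x) = p x + 1) (k : ℤ) (x : X) :
    p ((π ^ k) x) = p x + k := by
  induction k with
  | zero => simp
  | succ k ih => rw [add_comm, zpow_one_add, Equiv.Perm.mul_apply, hp, ih]; push_cast; ring
  | pred k ih =>
    have h := hp ((π ^ (-(k : ℤ) - 1)) x)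
    rw [← Equiv.Perm.mul_apply, ← zpow_one_add, add_sub_cancel, ih] at h
    rw [← sub_eq_iff_eq_add.2 h]
    push_cast
    ring

/-- If `π` raises heights modulo `N` by one, then `π ^ k` preserves a height only if `N ∣ k`. -/
theorem dvd_of_height_zpow_eq (hp : ∀ x, p (π x) = p x + 1) {k : ℤ} {x : X}
    (h : p ((π ^ k) x) = p x) : (N : ℤ) ∣ k := by
  rwa [height_zpow hp, add_eq_left, ZMod.intCast_zmod_eq_zero_iff_dvd] at h

/-- If `π` raises heights modulo `N` by one and `π ^ N = 1`, then `π ^ k` preserves the height of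
a point only when it is the identity. -/
theorem zpow_eq_one_of_height (hp : ∀ x, p (π x) = p x + 1) (hπ : π ^ N = 1) {k : ℤ} {x : X}
    (h : p ((π ^ k) x) = p x) : π ^ k = 1 := by
  obtain ⟨c, rfl⟩ := dvd_of_height_zpow_eq hp h
  rw [zpow_mul, zpow_natCast, hπ, one_zpow]

/-- The exponent of the power of `π` that brings `σ x` back to the height of `x`. -/
noncomputable def returnExponent (p : X → ZMod N) (σ : Equiv.Perm X) (x : X) : ℤ :=
  (p x - p (σ x)).cast

theorem height_return (hp : ∀ x, p (π x) = p x + 1) (x : X) :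
    p ((π ^ returnExponent p σ x) (σ x)) = p x := by
  rw [height_zpow hp, returnExponent, ZMod.intCast_zmod_cast]
  ring

/-- The permutation following `σ` by the power of `π` that restores the height `p`. -/
noncomputable def levelPerm [Finite X] (hp : ∀ x, p (π x) = p x + 1) (hπ : π ^ N = 1)
    (hc : Commute π σ) : Equiv.Perm X :=
  Equiv.ofBijective (fun x => (π ^ returnExponent p σ x) (σ x)) <|
    Finite.injective_iff_bijective.1 fun x y h => by
      have hxy : p x = p y := by
        rw [← height_return (σ := σ) hp x, ← height_return (σ := σ) hp y]
        exact congrArg p h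
      obtain ⟨k, hk⟩ : ∃ k : ℤ, x = (π ^ k) y := by
        refine ⟨-returnExponent p σ x + returnExponent p σ y, σ.injective ?_⟩
        rw [← Equiv.Perm.mul_apply σ, ← (hc.zpow_left _).eq, zpow_add, zpow_neg,
          Equiv.Perm.mul_apply, Equiv.Perm.mul_apply, Equiv.Perm.eq_inv_iff_eq]
        exact h
      rw [hk, zpow_eq_one_of_height hp hπ (k := k) (x := y) (by rw [← hk, hxy]),
        Equiv.Perm.one_apply]

section Finite

variable [Finite X] (hp : ∀ x, p (π x) = p x + 1) (hπ : π ^ N = 1) (hc : Commute π σ)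

theorem levelPerm_apply (x : X) :
    levelPerm hp hπ hc x = (π ^ returnExponent p σ x) (σ x) := rfl

theorem height_levelPerm_pow (k : ℕ) (x : X) : p ((levelPerm hp hπ hc ^ k) x) = p x := by
  induction k with
  | zero => simp
  | succ k ih => rw [pow_succ', Equiv.Perm.mul_apply, levelPerm_apply, height_return hp, ih]

theorem pow_apply_eq_levelPerm_pow (k : ℕ) (x : X) :
    (σ ^ k) x = (π ^ (-∑ i ∈ range k, returnExponent p σ ((levelPerm hp hπ hc ^ i) x)))
      ((levelPerm hp hπ hc ^ k) x) := by
  induction k with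
  | zero => simp
  | succ k ih =>
    rw [pow_succ', Equiv.Perm.mul_apply, ih, ← Equiv.Perm.mul_apply σ, ← (hc.zpow_left _).eq,
      pow_succ', Equiv.Perm.mul_apply (levelPerm hp hπ hc), levelPerm_apply,
      ← Equiv.Perm.mul_apply (π ^ _) (π ^ _), ← zpow_add, Equiv.Perm.mul_apply, sum_range_succ]
    congr 2
    ring

end Finite

/-- A finset is a joint orbit of `π` and `σ` when it consists of the images of any of its points
under the products of powers of `π` and `σ`. -/
def IsJointOrbit (π σ : Equiv.Perm X) (O : Finset X) : Prop :=
  O.Nonempty ∧ ∀ x ∈ O, ∀ y, y ∈ O ↔ ∃ i j : ℤ, (π ^ i * σ ^ j) x = y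

namespace IsJointOrbit

variable {O : Finset X}

theorem symm (hO : IsJointOrbit π σ O) (hc : Commute π σ) : IsJointOrbit σ π O := by
  refine ⟨hO.1, fun x hx y => (hO.2 x hx y).trans ?_⟩
  rw [exists_comm]
  simp only [(hc.zpow_zpow _ _).eq]

theorem zpow_mem (hO : IsJointOrbit π σ O) {x : X} (hx : x ∈ O) (k : ℤ) : (π ^ k) x ∈ O :=
  (hO.2 x hx _).2 ⟨k, 0, by simp⟩

theorem exists_height_eq_zero (hO : IsJointOrbit π σ O) (hp : ∀ x, p (π x) = p x + 1) :
    ∃ x ∈ O, p x = 0 := by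
  obtain ⟨y, hy⟩ := hO.1
  refine ⟨_, hO.zpow_mem hy (-(p y).cast), ?_⟩
  rw [height_zpow hp, Int.cast_neg, ZMod.intCast_zmod_cast, add_neg_cancel]

/-- All levels of the height function in a joint orbit have the same size. -/
theorem card_eq [NeZero N] (hO : IsJointOrbit π σ O) (hp : ∀ x, p (π x) = p x + 1) :
    #O = N * #{x ∈ O | p x = 0} := by
  rw [card_eq_sum_card_fiberwise (f := p) (t := univ) (fun _ _ => by simp),
    sum_const_nat (m := #{x ∈ O | p x = 0}) fun a _ => ?_, card_univ, ZMod.card]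
  symm
  refine card_nbij' (fun x => (π ^ (a.cast : ℤ)) x) (fun x => (π ^ (-a.cast : ℤ)) x) ?_ ?_ ?_ ?_
  · intro x hx
    simp only [coe_filter, Set.mem_ofPred_eq] at hx ⊢
    exact ⟨hO.zpow_mem hx.1 _, by rw [height_zpow hp, hx.2, ZMod.intCast_zmod_cast, zero_add]⟩
  · intro x hx
    simp only [coe_filter, Set.mem_ofPred_eq] at hx ⊢
    exact ⟨hO.zpow_mem hx.1 _, by
      rw [height_zpow hp, hx.2, Int.cast_neg, ZMod.intCast_zmod_cast, add_neg_cancel]⟩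
  · intro x _
    simp
  · intro x _
    simp

/-- On a joint orbit, the levels of the height `p` are permuted cyclically by `levelPerm`. -/
theorem isCycleOn_levelPerm [Finite X] (hO : IsJointOrbit π σ O)
    (hp : ∀ x, p (π x) = p x + 1) (hπ : π ^ N = 1) (hc : Commute π σ) :
    (levelPerm hp hπ hc).IsCycleOn ({x ∈ O | p x = 0} : Finset X) := by
  have hmaps : Set.MapsTo (levelPerm hp hπ hc) ({x ∈ O | p x = 0} : Finset X)
      ({x ∈ O | p x = 0} : Finset X) := by
    intro x hx
    simp only [coe_filter, Set.mem_ofPred_eq] at hx ⊢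
    refine ⟨hO.zpow_mem ?_ _, ?_⟩
    · simpa using (hO.symm hc).zpow_mem hx.1 1
    · rw [levelPerm_apply, height_return hp, hx.2]
  refine ⟨⟨hmaps, (levelPerm hp hπ hc).injective.injOn, ?_⟩, ?_⟩
  · exact Finset.surjOn_of_injOn_of_card_le _ hmaps (levelPerm hp hπ hc).injective.injOn le_rfl
  · intro x hx y hy
    simp only [coe_filter, Set.mem_ofPred_eq] at hx hy
    obtain ⟨i, j, hij⟩ := (hO.2 x hx.1 y).1 hy.1
    obtain ⟨k, hk : σ ^ k = σ ^ j⟩ := (mem_powers_iff_mem_zpowers (x := σ)).2 ⟨j, rfl⟩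
    refine ⟨k, ?_⟩
    rw [← hk, Equiv.Perm.mul_apply, pow_apply_eq_levelPerm_pow hp hπ hc, ← Equiv.Perm.mul_apply,
      ← zpow_add] at hij
    rw [zpow_natCast, ← hij, zpow_eq_one_of_height hp hπ (by
      rw [hij, height_levelPerm_pow hp hπ hc, hx.2, hy.2]), Equiv.Perm.one_apply]

/-- On a joint orbit consisting of `m` cycles of `π`, the permutation `σ ^ m` acts as `π ^ t`,
where `t` is the total height shift of `σ`. -/
theorem exists_pow_card_eq [Finite X] (hO : IsJointOrbit π σ O)
    (hp : ∀ x, p (π x) = p x + 1) (hπ : π ^ N = 1) (hσ : σ ^ N = 1) (hc : Commute π σ) :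
    ∃ t : ℤ, (t : ZMod N) = ∑ x ∈ O with p x = 0, (p (σ x) - p x) ∧
      (∀ x ∈ O, (σ ^ #{x ∈ O | p x = 0}) x = (π ^ t) x) ∧ #{x ∈ O | p x = 0} ∣ N := by
  obtain ⟨x, hxO, hx⟩ := hO.exists_height_eq_zero hp
  set S : Finset X := {x ∈ O | p x = 0} with hS
  have hxS : x ∈ S := by simp [hS, hxO, hx]
  have hcyc := hO.isCycleOn_levelPerm hp hπ hc
  rw [← hS] at hcyc
  refine ⟨-∑ i ∈ range #S, returnExponent p σ ((levelPerm hp hπ hc ^ i) x), ?_, ?_, ?_⟩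
  · push_cast
    rw [← sum_neg_distrib]
    refine sum_nbij (fun i => (levelPerm hp hπ hc ^ i) x) ?_ ?_ ?_ ?_
    · intro i _
      exact hcyc.1.mapsTo.perm_pow i hxS
    · intro i hi j hj hij
      exact Nat.ModEq.eq_of_lt_of_lt ((hcyc.pow_apply_eq_pow_apply hxS).1 hij)
        (by simpa using hi) (by simpa using hj)
    · intro y hy
      obtain ⟨k, hk, rfl⟩ := hcyc.exists_pow_eq hxS hy
      exact ⟨k, by simpa using hk, rfl⟩
    · intro i _
      simp only [returnExponent, ZMod.intCast_zmod_cast, neg_sub, Equiv.Perm.iterate_eq_pow]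
  · intro y hy
    obtain ⟨i, j, rfl⟩ := (hO.2 x hxO y).1 hy
    have h := pow_apply_eq_levelPerm_pow hp hπ hc #S x
    rw [hcyc.pow_card_apply hxS] at h
    have h₁ : Commute (σ ^ #S) (π ^ i * σ ^ j) :=
      ((hc.symm.pow_left _).zpow_right _).mul_right (((Commute.refl σ).pow_left _).zpow_right _)
    rw [← Equiv.Perm.mul_apply, h₁.eq, Equiv.Perm.mul_apply, h, ← Equiv.Perm.mul_apply,
      ← Equiv.Perm.mul_apply]
    congr 1
    exact ((((Commute.refl π).zpow_right _).mul_right (hc.zpow_right _)).zpow_left _).eq.symm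
  · rw [← hcyc.pow_apply_eq hxS]
    have h := pow_apply_eq_levelPerm_pow hp hπ hc N x
    rw [hσ, Equiv.Perm.one_apply] at h
    have h₁ := zpow_eq_one_of_height hp hπ (x := (levelPerm hp hπ hc ^ N) x)
      ((congrArg p h).symm.trans (height_levelPerm_pow hp hπ hc N x).symm)
    rw [h₁, Equiv.Perm.one_apply] at h
    exact h.symm

/-- On a joint orbit, the two total shifts add up to twice the number of cycles, modulo `4`. -/
theorem castHom_shift_add_shift [Finite X] [NeZero N] (hO : IsJointOrbit π σ O) (h4 : 4 ∣ N)
    (hp : ∀ x, p (π x) = p x + 1) (hq : ∀ x, q (σ x) = q x + 1)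
    (hπ : π ^ N = 1) (hσ : σ ^ N = 1) (hc : Commute π σ) :
    ZMod.castHom h4 (ZMod 4) (∑ x ∈ O with p x = 0, (p (σ x) - p x)) +
      ZMod.castHom h4 (ZMod 4) (∑ x ∈ O with q x = 0, (q (π x) - q x)) =
      2 * #{x ∈ O | p x = 0} := by
  obtain ⟨t, ht, hσt, K, hK⟩ := hO.exists_pow_card_eq hp hπ hσ hc
  obtain ⟨s, hs, hπs, -⟩ := (hO.symm hc).exists_pow_card_eq hq hσ hπ hc.symm
  have hcard : #{x ∈ O | q x = 0} = #{x ∈ O | p x = 0} :=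
    Nat.eq_of_mul_eq_mul_left (NeZero.pos N)
      (((hO.symm hc).card_eq hq).symm.trans (hO.card_eq hp))
  rw [hcard] at hπs
  rw [← ht, ← hs]
  obtain ⟨x, hx⟩ := hO.1
  generalize #{x ∈ O | p x = 0} = m at *
  have hK0 : (K : ℤ) ≠ 0 := by
    rintro h
    apply NeZero.ne N
    rw [hK, Nat.cast_eq_zero.1 h, mul_zero]
  have hm0 : (m : ℤ) ≠ 0 := by
    rintro h
    apply NeZero.ne N
    rw [hK, Nat.cast_eq_zero.1 h, zero_mul]
  have hct : Commute (σ ^ m) (π ^ t) := (hc.symm.pow_left _).zpow_right _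
  have hcs : Commute (π ^ m) (σ ^ s) := (hc.pow_left _).zpow_right _
  have hmt : (m : ℤ) ∣ t := by
    have h := hct.zpow_apply_eq_of_apply_eq (hσt x hx) K
    rw [zpow_natCast, ← pow_mul, ← hK, hσ, Equiv.Perm.one_apply, ← zpow_mul] at h
    have := dvd_of_height_zpow_eq hp (congrArg p h.symm)
    rw [hK, Nat.cast_mul] at this
    exact Int.dvd_of_mul_dvd_mul_right hK0 this
  have hms : (m : ℤ) ∣ s := by
    have h := hcs.zpow_apply_eq_of_apply_eq (hπs x hx) K
    rw [zpow_natCast, ← pow_mul, ← hK, hπ, Equiv.Perm.one_apply, ← zpow_mul] at h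
    have := dvd_of_height_zpow_eq hq (congrArg q h.symm)
    rw [hK, Nat.cast_mul] at this
    exact Int.dvd_of_mul_dvd_mul_right hK0 this
  obtain ⟨u, rfl⟩ := hmt
  obtain ⟨v, rfl⟩ := hms
  have huv : (K : ℤ) ∣ u * v - 1 := by
    have h := hct.zpow_apply_eq_of_apply_eq (hσt x hx) v
    rw [← zpow_natCast, ← zpow_mul, ← hπs x hx, ← zpow_mul] at h
    have := congrArg p h
    rw [← zpow_natCast, height_zpow hp, height_zpow hp, add_right_inj, eq_comm, ← sub_eq_zero,
      ← Int.cast_sub, ZMod.intCast_zmod_eq_zero_iff_dvd, hK, Nat.cast_mul,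
      show (m : ℤ) * u * v - m = m * (u * v - 1) by ring] at this
    exact Int.dvd_of_mul_dvd_mul_left hm0 this
  have h := four_dvd_of_mul_modEq_one (m := m) (K := K) (by rw [hK] at h4; exact_mod_cast h4) huv
  rw [map_intCast, map_intCast, ← sub_eq_zero]
  exact_mod_cast (ZMod.intCast_zmod_eq_zero_iff_dvd _ 4).2 h

end IsJointOrbit

/-- The joint orbits of `π` and `σ` as classes of an equivalence relation. -/
def jointOrbitSetoid (hc : Commute π σ) : Setoid X where
  r x y := ∃ i j : ℤ, (π ^ i * σ ^ j) x = y
  iseqv := by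
    refine ⟨fun x => ⟨0, 0, by simp⟩, ?_, ?_⟩
    · rintro x _ ⟨i, j, rfl⟩
      refine ⟨-i, -j, ?_⟩
      rw [zpow_neg, zpow_neg, (hc.zpow_zpow i j).inv_inv.eq, ← mul_inv_rev,
        ← Equiv.Perm.mul_apply, inv_mul_cancel, Equiv.Perm.one_apply]
    · rintro x _ _ ⟨i, j, rfl⟩ ⟨k, l, rfl⟩
      refine ⟨k + i, l + j, ?_⟩
      rw [zpow_add, zpow_add, ← Equiv.Perm.mul_apply, mul_assoc, mul_assoc,
        ← mul_assoc (σ ^ l), ← (hc.zpow_zpow i l).eq, mul_assoc]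

/-- If `π` and `σ` commute and all their cycles have length `N` divisible by `4`, then the total
shift of `σ` along the cycles of `π` and the total shift of `π` along the cycles of `σ` add up to
twice the number of cycles, modulo `4`. -/
theorem castHom_totalShift_add_totalShift [Fintype X] [NeZero N] (h4 : 4 ∣ N)
    (hp : ∀ x, p (π x) = p x + 1) (hq : ∀ x, q (σ x) = q x + 1)
    (hπ : π ^ N = 1) (hσ : σ ^ N = 1) (hc : Commute π σ) :
    ZMod.castHom h4 (ZMod 4) (∑ x with p x = 0, (p (σ x) - p x)) +
      ZMod.castHom h4 (ZMod 4) (∑ x with q x = 0, (q (π x) - q x)) =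
      2 * #{x | p x = 0} := by
  classical
  let c : X → Quotient (jointOrbitSetoid hc) := Quotient.mk _
  have hO : ∀ o, IsJointOrbit π σ {x | c x = o} := by
    intro o
    obtain ⟨z, rfl⟩ := Quotient.exists_rep o
    refine ⟨⟨z, by simp [c]⟩, fun x hx y => ?_⟩
    simp only [mem_filter, mem_univ, true_and] at hx ⊢
    rw [← hx, eq_comm]
    exact Quotient.eq
  have hsum : ∀ (M : Type) [AddCommMonoid M] (P : X → Prop) [DecidablePred P] (f : X → M),
      ∑ x with P x, f x = ∑ o, ∑ x ∈ ({x | c x = o} : Finset X) with P x, f x := by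
    intro M _ P _ f
    rw [← sum_fiberwise _ c]
    simp only [filter_filter, and_comm]
  rw [hsum, hsum, card_eq_sum_ones, hsum, map_sum, map_sum, ← sum_add_distrib, Nat.cast_sum,
    mul_sum]
  refine sum_congr rfl fun o _ => ?_
  rw [← card_eq_sum_ones]
  exact (hO o).castHom_shift_add_shift h4 hp hq hπ hσ hc

end Heights

/-- A permutation that fixes the block `b` of each point and raises its height `p` by an
amount `φ` depending only on the block. -/
def IsBlockShift {X ι : Type*} {N : ℕ} (b : X → ι) (p : X → ZMod N) (f : Equiv.Perm X)
    (φ : ι → ZMod N) : Prop :=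
  ∀ x, b (f x) = b x ∧ p (f x) = p x + φ (b x)

namespace IsBlockShift

variable {X ι : Type*} {N : ℕ} {b : X → ι} {p : X → ZMod N} {f h : Equiv.Perm X}
  {φ ψ : ι → ZMod N}

theorem one : IsBlockShift b p 1 0 := fun x => by simp

theorem mul (hf : IsBlockShift b p f φ) (hh : IsBlockShift b p h ψ) :
    IsBlockShift b p (f * h) (φ + ψ) := fun x => by
  rw [Equiv.Perm.mul_apply, (hf _).1, (hf _).2, (hh x).1, (hh x).2, Pi.add_apply]
  exact ⟨rfl, by ring⟩

theorem inv (hf : IsBlockShift b p f φ) : IsBlockShift b p f⁻¹ (-φ) := fun x => by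
  obtain ⟨y, rfl⟩ := f.surjective x
  rw [← Equiv.Perm.mul_apply, inv_mul_cancel, Equiv.Perm.one_apply, (hf y).1, (hf y).2]
  exact ⟨rfl, by simp⟩

theorem pow (hf : IsBlockShift b p f φ) (k : ℕ) : IsBlockShift b p (f ^ k) (k • φ) := by
  induction k with
  | zero => simpa using one
  | succ k ih => rw [pow_succ, succ_nsmul]; exact ih.mul hf

theorem zpow (hf : IsBlockShift b p f φ) (k : ℤ) : IsBlockShift b p (f ^ k) (k • φ) := by
  cases k with
  | ofNat k => simpa using hf.pow k
  | negSucc k => rw [zpow_negSucc, negSucc_zsmul]; exact (hf.pow _).inv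

theorem list_prod {κ : Type*} {F : κ → Equiv.Perm X} {Φ : κ → ι → ZMod N}
    (hF : ∀ j, IsBlockShift b p (F j) (Φ j)) (l : List κ) :
    IsBlockShift b p (l.map F).prod (l.map Φ).sum := by
  induction l with
  | nil => exact one
  | cons j l ih => simpa using (hF j).mul ih

end IsBlockShift

/-- A permutation in the subgroup generated by height-preserving permutations preserves heights. -/
theorem height_apply_of_mem_closure {X Y : Type*} {p : X → Y} {S : Set (Equiv.Perm X)}
    (hS : ∀ f ∈ S, ∀ x, p (f x) = p x) {f : Equiv.Perm X} (hf : f ∈ Subgroup.closure S) (x : X) :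
    p (f x) = p x := by
  induction hf using Subgroup.closure_induction generalizing x with
  | mem f hf => exact hS f hf x
  | one => rfl
  | mul f h _ _ ihf ihh => rw [Equiv.Perm.mul_apply, ihf, ihh]
  | inv f _ ih => rw [← ih, ← Equiv.Perm.mul_apply, mul_inv_cancel, Equiv.Perm.one_apply]

/-- The total shift of the product of a block shift and a height-preserving permutation. -/
theorem sum_shift_eq_of_isBlockShift {X ι : Type*} [Fintype X] {N : ℕ} {b : X → ι}
    {p : X → ZMod N} {f h : Equiv.Perm X} {φ : ι → ZMod N} (hf : IsBlockShift b p f φ)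
    (hh : ∀ x, p (h x) = p x) :
    ∑ x with p x = 0, (p ((f * h) x) - p x) = ∑ x with p x = 0, φ (b x) := by
  refine sum_equiv h (by simp [hh]) fun x _ => ?_
  rw [Equiv.Perm.mul_apply, (hf _).2, hh, add_sub_cancel_left]

/-- Summing over the bottom elements of the `n` blocks of size `N` is summing over the blocks. -/
theorem sum_bottom_eq {N n : ℕ} (hN : 0 < N) {M : Type*} [AddCommMonoid M]
    {b : Fin (N * n) → Fin n} (hb : ∀ x, (b x : ℕ) = x / N) {p : Fin (N * n) → ZMod N}
    (hp : ∀ x, p x = (x : ℕ)) (φ : Fin n → M) :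
    ∑ x with p x = 0, φ (b x) = ∑ j, φ j := by
  refine sum_bij' (fun x _ => b x)
    (fun j _ => ⟨N * j, Nat.mul_lt_mul_of_pos_left j.isLt hN⟩) ?_ ?_ ?_ ?_ ?_
  · simp
  · simp [hp]
  · intro x hx
    rw [mem_filter, hp, ZMod.natCast_eq_zero_iff] at hx
    ext
    simp only [hb]
    exact Nat.mul_div_cancel' hx.2
  · intro j _
    ext
    simp [hb, hN]
  · simp

/-- A permutation rotating each block of size `N` by one position has order dividing `N`. -/
theorem pow_eq_one_of_rotate {N n : ℕ} {π : Equiv.Perm (Fin (N * n))}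
    (hπ : ∀ x : Fin (N * n),
      ((π x : ℕ)) = N * ((x : ℕ) / N) + ((x : ℕ) % N + 1) % N) : π ^ N = 1 := by
  rcases N.eq_zero_or_pos with rfl | hN
  · exact pow_zero _
  have key : ∀ (k : ℕ) (x : Fin (N * n)),
      (((π ^ k) x : Fin (N * n)) : ℕ) = N * ((x : ℕ) / N) + ((x : ℕ) % N + k) % N := by
    intro k x
    induction k with
    | zero => simp [Nat.div_add_mod]
    | succ k ih =>
      rw [pow_succ', Equiv.Perm.mul_apply, hπ, ih, Nat.mul_add_div hN,
        Nat.div_eq_of_lt (Nat.mod_lt _ hN), Nat.mul_add_mod, Nat.mod_mod, Nat.mod_add_mod,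
        add_zero, add_assoc]
  ext x
  rw [key, Nat.add_mod_right, Nat.mod_mod, Nat.div_add_mod, Equiv.Perm.one_apply]

end


/-- Let `r ≥ 2` be even and let `n ≥ 2` be even.  In `S_{2rn}` (on
`Fin (2*r*n)`, `0`-indexed), for `0 ≤ j < n` let `A j` be the `2r`-cycle on the
`j`-th block of size `2r`, `π = A_0 ⋯ A_{n-1}`, and for `0 ≤ i < n-1` let `B i`
swap blocks `i` and `i+1` position-by-position.  Let `g` be such that `g π g⁻¹`
commutes with `π`, and suppose `g π g⁻¹ = A_0^{d_0} ⋯ A_{n-1}^{d_{n-1}} · B₀` and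
`g⁻¹ π g = A_0^{e_0} ⋯ A_{n-1}^{e_{n-1}} · B₀'` with integers `d_j, e_j` and
`B₀, B₀'` in the subgroup generated by the `B i`'s.  Then `∑_j (e_j + d_j) ≡ 0 (mod 4)`. -/
theorem stmt11 (r n : ℕ) (hr : 2 ≤ r) (hreven : Even r) (hn : 2 ≤ n) (hneven : Even n)
    (A : ℕ → Equiv.Perm (Fin (2 * r * n)))
    (hA : ∀ j < n, ∀ x : Fin (2 * r * n),
      ((A j x : ℕ)) = if (x : ℕ) / (2 * r) = j
        then 2 * r * j + ((x : ℕ) % (2 * r) + 1) % (2 * r) else (x : ℕ))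
    (π : Equiv.Perm (Fin (2 * r * n)))
    (hπ : ∀ x : Fin (2 * r * n),
      ((π x : ℕ)) = 2 * r * ((x : ℕ) / (2 * r)) + ((x : ℕ) % (2 * r) + 1) % (2 * r))
    (B : ℕ → Equiv.Perm (Fin (2 * r * n)))
    (hB : ∀ i, i + 1 < n → ∀ x : Fin (2 * r * n),
      ((B i x : ℕ)) = if (x : ℕ) / (2 * r) = i then (x : ℕ) + 2 * r
        else if (x : ℕ) / (2 * r) = i + 1 then (x : ℕ) - 2 * r else (x : ℕ))
    (g : Equiv.Perm (Fin (2 * r * n)))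
    (hcomm : Commute (g * π * g⁻¹) π)
    (d e : Fin n → ℤ) (B₀ B₀' : Equiv.Perm (Fin (2 * r * n)))
    (hB₀ : B₀ ∈ Subgroup.closure (B '' {i | i + 1 < n}))
    (hB₀' : B₀' ∈ Subgroup.closure (B '' {i | i + 1 < n}))
    (hd : g * π * g⁻¹ = (List.ofFn fun j : Fin n => A (j : ℕ) ^ d j).prod * B₀)
    (he : g⁻¹ * π * g = (List.ofFn fun j : Fin n => A (j : ℕ) ^ e j).prod * B₀') :
    (4 : ℤ) ∣ ∑ j : Fin n, (e j + d j) := by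

  have hN : 0 < 2 * r := by omega
  have : NeZero (2 * r) := ⟨hN.ne'⟩
  have h4 : 4 ∣ 2 * r := by obtain ⟨k, rfl⟩ := hreven; exact ⟨k, by ring⟩
  let b : Fin (2 * r * n) → Fin n := fun x => ⟨x / (2 * r), Nat.div_lt_of_lt_mul x.isLt⟩
  let p : Fin (2 * r * n) → ZMod (2 * r) := fun x => ((x : ℕ) : ZMod (2 * r))
  have hb : ∀ x, (b x : ℕ) = x / (2 * r) := fun _ => rfl
  have hp : ∀ x, p x = (x : ℕ) := fun _ => rfl
  have hzero : ∀ a : ℕ, ((2 * r * a : ℕ) : ZMod (2 * r)) = 0 := fun a => by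
    rw [Nat.cast_mul, ZMod.natCast_self, zero_mul]
  have hpπ : ∀ x, p (π x) = p x + 1 := fun x => by
    rw [hp, hp, hπ, Nat.cast_add, hzero, zero_add, ZMod.natCast_mod, Nat.cast_add,
      ZMod.natCast_mod, Nat.cast_one]
  have hAshift : ∀ j : Fin n, IsBlockShift b p (A j) (Pi.single j 1) := by
    intro j x
    have h := hA j j.isLt x
    split_ifs at h with hx
    · obtain rfl : b x = j := Fin.ext hx
      constructor
      · ext
        rw [hb, h, Nat.mul_add_div hN, Nat.div_eq_of_lt (Nat.mod_lt _ hN), add_zero]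
      · rw [hp, hp, h, Nat.cast_add, hzero, zero_add, ZMod.natCast_mod, Nat.cast_add,
          ZMod.natCast_mod, Nat.cast_one, Pi.single_eq_same]
    · have hne : b x ≠ j := fun hj => hx (congrArg Fin.val hj)
      rw [Fin.ext h, Pi.single_eq_of_ne hne, add_zero]
      exact ⟨rfl, rfl⟩
  have hprod : ∀ c : Fin n → ℤ,
      IsBlockShift b p (List.ofFn fun j : Fin n => A (j : ℕ) ^ c j).prod fun j => c j := by
    intro c
    have h := IsBlockShift.list_prod (fun j => (hAshift j).zpow (c j)) (List.finRange n)
    rw [← List.ofFn_eq_map, ← List.ofFn_eq_map, List.sum_ofFn] at h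
    convert h using 1
    ext j
    simp [Finset.sum_apply, Pi.single_apply]
  have hpB : ∀ f ∈ Subgroup.closure (B '' {i | i + 1 < n}), ∀ x, p (f x) = p x := by
    refine fun f hf => height_apply_of_mem_closure ?_ hf
    rintro _ ⟨i, hi, rfl⟩ x
    rw [hp, hp, hB i hi x]
    split_ifs with h₁ h₂
    · rw [Nat.cast_add, ZMod.natCast_self, add_zero]
    · have hle : 2 * r ≤ (x : ℕ) := by
        by_contra hlt
        rw [Nat.div_eq_of_lt (not_le.1 hlt)] at h₂
        omega
      rw [Nat.cast_sub hle, ZMod.natCast_self, sub_zero]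
    · rfl
  have hπpow : π ^ (2 * r) = 1 := pow_eq_one_of_rotate hπ
  have hmain := castHom_totalShift_add_totalShift (q := fun x => p (g⁻¹ x)) h4 hpπ
    (σ := g * π * g⁻¹) (fun x => by simp [hpπ]) hπpow (by rw [conj_pow, hπpow]; simp) hcomm.symm
  have hq : ∑ x with p (g⁻¹ x) = 0, (p (g⁻¹ (π x)) - p (g⁻¹ x)) =
      ∑ x with p x = 0, (p ((g⁻¹ * π * g) x) - p x) :=
    Finset.sum_equiv g⁻¹ (by simp) fun x _ => by simp
  have hcard : (Finset.card {x | p x = 0} : ZMod 4) = n := by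
    rw [Finset.card_eq_sum_ones, sum_bottom_eq hN hb hp fun _ => 1]
    simp
  have h2n : (2 : ZMod 4) * n = 0 := by
    obtain ⟨k, rfl⟩ := hneven
    rw [← two_mul, Nat.cast_mul, ← mul_assoc]
    exact zero_mul _
  rw [hq, hd, he, sum_shift_eq_of_isBlockShift (hprod d) (hpB _ hB₀),
    sum_shift_eq_of_isBlockShift (hprod e) (hpB _ hB₀'),
    sum_bottom_eq hN hb hp fun j => (d j : ZMod (2 * r)),
    sum_bottom_eq hN hb hp fun j => (e j : ZMod (2 * r)), hcard, h2n, ← Int.cast_sum,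
    ← Int.cast_sum, map_intCast, map_intCast, ← Int.cast_add, ZMod.intCast_zmod_eq_zero_iff_dvd] at hmain
  rw [Finset.sum_add_distrib, add_comm]
  exact hmain
end

section
/- Let r ≥ 2 be even and n ≥ 2. In S_{2rn}, for 1 ≤ j ≤ n let A_j be the 2r-cycle (2r(j-1)+1, …, 2rj), let π = A_1⋯A_n, and for 1 ≤ i ≤ n-1 let B_i = ∏_{m=1}^{2r}(2r(i-1)+m, 2ri+m), so that the centralizer of π in S_{2rn} is generated by A_1,…,A_n, B_1,…,B_{n-1}. Let ζ ∈ {i, -1, -i} (a primitive 4th root of unity or -1), let μ ∈ {1,-1}, and let ρ be a group homomorphism from the centralizer of π to ℂˣ with ρ(A_j) = ζ for all 1 ≤ j ≤ n and ρ(B_i) = μ for all 1 ≤ i ≤ n-1, and assume ρ(π) = -1. Then for all elements t, t' in the conjugacy class of π with t t' = t' t, and all g, g' ∈ S_{2rn} with g π g⁻¹ = t and g' π g'⁻¹ = t', the elements g'⁻¹ t g' and g⁻¹ t' g lie in the centralizer of π, ρ(g⁻¹ t g) = -1, and ρ(g'⁻¹ t g') · ρ(g⁻¹ t' g) = 1.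 (In the paper's terminology: for r even and ρ = χ_{c,…,c} ⊗ μ with c ∈ {r/2, r, 3r/2} and ρ(π) = -1, the braiding is negative.) -/
open Equiv Function in
/-- Two permutations of a finite type are conjugate, hence have the same sign, if their cycles can
be matched in such a way that matched cycles have the same length. -/
theorem sign_eq_of_cycle_matching {α Q : Type*} [Fintype α] [DecidableEq α] {σ τ : Perm α}
    (b b' : Q → α) (hb : ∀ i, ∃ q, σ.SameCycle (b q) i)
    (hbinj : ∀ q q', σ.SameCycle (b q) (b q') → q = q')
    (hbinj' : ∀ q q', τ.SameCycle (b' q) (b' q') → q = q')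
    (hper : ∀ q (j : ℤ), (σ ^ j) (b q) = b q ↔ (τ ^ j) (b' q) = b' q) :
    Perm.sign σ = Perm.sign τ := by
  have hper2 : ∀ q (j l : ℤ), (σ ^ j) (b q) = (σ ^ l) (b q) ↔
      (τ ^ j) (b' q) = (τ ^ l) (b' q) := by
    intro q j l
    have key : ∀ (θ : Perm α) (c : α), (θ ^ j) c = (θ ^ l) c ↔ (θ ^ (j - l)) c = c := by
      intro θ c
      rw [sub_eq_neg_add, zpow_add, zpow_neg, Perm.mul_apply, Perm.inv_eq_iff_eq, eq_comm]
    rw [key, key, hper]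
  choose q j hj using hb
  let c : α → α := fun i => (τ ^ j i) (b' (q i))
  have hc : ∀ (i : α) (q₀ : Q) (l : ℤ), (σ ^ l) (b q₀) = i → c i = (τ ^ l) (b' q₀) := by
    intro i q₀ l h
    have hq : q i = q₀ :=
      hbinj _ _ (Perm.SameCycle.trans ⟨j i, hj i⟩ (Perm.SameCycle.symm ⟨l, h⟩))
    subst hq
    exact (hper2 _ _ _).1 ((hj i).trans h.symm)
  have hcinj : Injective c := by
    intro i i' h
    have hq : q i = q i' := hbinj' _ _
      (Perm.SameCycle.trans ⟨j i, rfl⟩ (Perm.SameCycle.symm ⟨j i', h.symm⟩))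
    rw [← hj i, ← hj i', ← hq, hper2]
    simpa [c, ← hq] using h
  let e : α ≃ α := Equiv.ofBijective c (Finite.injective_iff_bijective.1 hcinj)
  have hconj : e.permCongr σ = τ := by
    ext y
    obtain ⟨i, rfl⟩ := e.surjective y
    rw [Equiv.permCongr_apply, Equiv.symm_apply_apply]
    change c (σ i) = τ (c i)
    rw [hc (σ i) (q i) (1 + j i) (by rw [zpow_add, Perm.mul_apply, hj, zpow_one]),
      zpow_add, Perm.mul_apply, zpow_one]
  rw [← hconj, Perm.sign_permCongr]

open Equiv Function in
/-- The sum over a cycle of a permutation, computed along the orbit of a point. -/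
theorem sum_filter_sameCycle {α M : Type*} [Fintype α] [AddCommMonoid M] (σ : Perm α) (b : α)
    [DecidablePred fun i => σ.SameCycle b i] (d : α → M) :
    ∑ i with σ.SameCycle b i, d i = ∑ j ∈ Finset.range (minimalPeriod σ b), d ((σ ^ j) b) := by
  classical
  have hinj : Set.InjOn (fun j => (σ ^ j) b) (Finset.range (minimalPeriod σ b)) := by
    intro j hj l hl h
    simp only [Finset.coe_range, Set.mem_Iio] at hj hl
    simp only [← Perm.iterate_eq_pow] at h
    exact (iterate_eq_iterate_iff_of_lt_minimalPeriod hj hl).1 h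
  rw [← Finset.sum_image (f := d) (g := fun j => (σ ^ j) b) hinj]
  refine Finset.sum_congr ?_ fun _ _ => rfl
  ext i
  simp only [Finset.mem_filter, Finset.mem_univ, true_and, Finset.mem_image, Finset.mem_range]
  constructor
  · intro h
    obtain ⟨m, rfl⟩ := h.exists_nat_pow_eq
    refine ⟨m % minimalPeriod σ b, Nat.mod_lt _ (minimalPeriod_pos_of_mem_periodicPts ?_), ?_⟩
    · exact σ.injective.mem_periodicPts b
    · simp only [← Perm.iterate_eq_pow]
      exact iterate_mod_minimalPeriod_eq
  · rintro ⟨m, -, rfl⟩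
    exact ⟨m, by simp⟩

/-- Arithmetic of a lattice of relations between two commuting permutations. -/
theorem relation_lattice_dvd {N k k' a : ℤ} (hN : 0 < N) (L : AddSubgroup (ℤ × ℤ))
    (h₁ : ∀ i, (i, 0) ∈ L ↔ N ∣ i) (h₂ : ∀ j, (0, j) ∈ L ↔ N ∣ j)
    (hk : ∀ i j, (i, j) ∈ L → k ∣ j) (hk' : ∀ i j, (i, j) ∈ L → k' ∣ i) (ha : (-a, k) ∈ L) :
    k' ∣ k ∧ ∃ u v w M, N = k * M ∧ a = k * u ∧ u * v + M * w = 1 ∧ (-k, k * v) ∈ L := by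
  have hmul : ∀ (m : ℤ) (i j : ℤ), (i, j) ∈ L → (m * i, m * j) ∈ L := by
    intro m i j h
    simpa using L.zsmul_mem h m
  obtain ⟨M, hM⟩ := hk 0 N ((h₂ N).2 dvd_rfl)
  have hk0 : k ≠ 0 := by rintro rfl; simp at hM; omega
  have hM0 : M ≠ 0 := by rintro rfl; simp at hM; omega
  have hka : k ∣ a := by
    have h := L.sub_mem (hmul M _ _ ha) ((h₂ N).2 dvd_rfl)
    have h' : (M * -a, (0 : ℤ)) ∈ L := by
      convert h using 1
      simp [hM, mul_comm]
    obtain ⟨s, hs⟩ := (h₁ _).1 h'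
    refine ⟨-s, mul_left_cancel₀ hM0 ?_⟩
    rw [hM] at hs
    linear_combination -hs
  obtain ⟨u, rfl⟩ := hka
  have hcop : IsCoprime u M := by
    rw [Int.isCoprime_iff_gcd_eq_one]
    obtain ⟨u', hu'⟩ := Int.gcd_dvd_left u M
    obtain ⟨M', hM'⟩ := Int.gcd_dvd_right u M
    set d : ℤ := (Int.gcd u M : ℤ) with hd
    have h := L.add_mem (hmul M' _ _ ha) ((h₁ (N * u')).2 (dvd_mul_right _ _))
    have h' : ((0 : ℤ), k * M') ∈ L := by
      convert h using 1
      refine Prod.ext ?_ ?_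
      · change 0 = M' * -(k * u) + N * u'
        rw [hM]
        linear_combination k * M' * hu' - k * u' * hM'
      · change k * M' = M' * k + 0
        ring
    obtain ⟨s, hs⟩ := (h₂ _).1 h'
    have hM'0 : M' ≠ 0 := by rintro rfl; simp at hM'; omega
    have h1 : d * s = 1 := by
      refine mul_left_cancel₀ (mul_ne_zero hk0 hM'0) ?_
      rw [hM] at hs
      linear_combination -hs - k * s * hM'
    have : (Int.gcd u M : ℤ) = 1 := Int.eq_one_of_mul_eq_one_right (by positivity) h1
    exact_mod_cast this
  obtain ⟨v, w, hvw⟩ := hcop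
  have hmem : (-k, k * v) ∈ L := by
    have h := L.sub_mem (hmul v _ _ ha) ((h₁ (N * w)).2 (dvd_mul_right _ _))
    convert h using 1
    refine Prod.ext ?_ ?_
    · change -k = v * -(k * u) - N * w
      rw [hM]
      linear_combination k * hvw
    · change k * v = v * k - 0
      ring
  exact ⟨by simpa using hk' _ _ hmem, u, v, w, M, hM, rfl, by linear_combination hvw, hmem⟩

theorem relation_lattice_sum {N k k' a b : ℤ} (hN : 0 < N) (h4 : 4 ∣ N) (hk0 : 0 ≤ k)
    (hk0' : 0 ≤ k') (L : AddSubgroup (ℤ × ℤ))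
    (h₁ : ∀ i, (i, 0) ∈ L ↔ N ∣ i) (h₂ : ∀ j, (0, j) ∈ L ↔ N ∣ j)
    (hk : ∀ i j, (i, j) ∈ L → k ∣ j) (hk' : ∀ i j, (i, j) ∈ L → k' ∣ i)
    (ha : (-a, k) ∈ L) (hb : (k', -b) ∈ L) :
    k = k' ∧ ((a + b : ℤ) : ZMod 4) = 2 * (k : ZMod 4) := by
  obtain ⟨hdvd, u, v, w, M, hM, rfl, huv, hmem⟩ :=
    relation_lattice_dvd hN L h₁ h₂ hk hk' ha
  have hswap : ∀ i j, (i, j) ∈ L.comap (AddEquiv.prodComm : ℤ × ℤ ≃+ ℤ × ℤ).toAddMonoidHom ↔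
      (j, i) ∈ L := fun i j => Iff.rfl
  obtain ⟨hdvd', -⟩ := relation_lattice_dvd hN
    (L.comap (AddEquiv.prodComm : ℤ × ℤ ≃+ ℤ × ℤ).toAddMonoidHom)
    (fun i => h₂ i) (fun i => h₁ i) (fun i j h => hk' j i h) (fun i j h => hk j i h)
    (a := b) ((hswap _ _).2 hb)
  obtain rfl : k = k' := Int.dvd_antisymm hk0 hk0' hdvd' hdvd
  refine ⟨rfl, ?_⟩
  have hdiff : N ∣ k * v - b := by
    rw [← h₂]
    have h := L.add_mem hmem hb
    convert h using 1
    refine Prod.ext ?_ ?_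
    · change (0 : ℤ) = -k + k
      ring
    · change k * v - b = k * v + -b
      ring
  have e1 : (k : ZMod 4) * M = 0 := by
    have := (ZMod.intCast_zmod_eq_zero_iff_dvd N 4).2 h4
    rw [hM] at this
    exact_mod_cast this
  have e2 : (u : ZMod 4) * v + M * w = 1 := by exact_mod_cast congrArg (Int.cast : ℤ → ZMod 4) huv
  have e3 : (b : ZMod 4) = k * v := by
    have := (ZMod.intCast_zmod_eq_zero_iff_dvd (k * v - b) 4).2 (h4.trans hdiff)
    push_cast at this
    exact (sub_eq_zero.1 this).symm
  push_cast
  rw [e3]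
  generalize (k : ZMod 4) = K at *
  generalize (u : ZMod 4) = U at *
  generalize (v : ZMod 4) = V at *
  generalize (M : ZMod 4) = M₁ at *
  generalize (w : ZMod 4) = W at *
  clear e3
  revert K U V M₁ W
  decide

open Equiv Function

/-- `blk` identifies the cycles of `p`, all of length `N`, with `Fin n`; `φ` is a labelling
modulo `4` of the points which increases by `1` along `p`; the permutation `x` induces `σ` on the
cycles of `p`, and shifts the labels by `d`. -/
structure CycleLabelling (N n : ℕ) {Ω : Type*} (p x : Perm Ω) (blk : Ω → Fin n) (φ : Ω → ZMod 4)
    (σ : Perm (Fin n)) (d : Fin n → ℕ) : Prop where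
  surj : Surjective blk
  blk_eq_iff : ∀ w z, blk w = blk z ↔ ∃ i : ℤ, (p ^ i) z = w
  zpow_apply_eq_iff : ∀ (i : ℤ) z, (p ^ i) z = z ↔ (N : ℤ) ∣ i
  label_self : ∀ z, φ (p z) = φ z + 1
  blk_apply : ∀ z, blk (x z) = σ (blk z)
  label_apply : ∀ z, φ (x z) = φ z + d (blk z)

namespace CycleLabelling

variable {N n : ℕ} {Ω : Type*} {p x : Perm Ω} {blk : Ω → Fin n} {φ : Ω → ZMod 4}
  {σ : Perm (Fin n)} {d : Fin n → ℕ}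

theorem blk_pow (H : CycleLabelling N n p x blk φ σ d) (j : ℕ) (z : Ω) :
    blk ((x ^ j) z) = (σ ^ j) (blk z) := by
  induction j with
  | zero => simp
  | succ j ih => rw [pow_succ', pow_succ', Perm.mul_apply, Perm.mul_apply, H.blk_apply, ih]

theorem blk_zpow (H : CycleLabelling N n p x blk φ σ d) (j : ℤ) (z : Ω) :
    blk ((x ^ j) z) = (σ ^ j) (blk z) := by
  obtain ⟨m, rfl | rfl⟩ := j.eq_nat_or_neg
  · simpa using H.blk_pow m z
  · rw [zpow_neg, zpow_neg, Perm.eq_inv_iff_eq, zpow_natCast, zpow_natCast, ← H.blk_pow,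
      Perm.coe_inv, Equiv.apply_symm_apply]

theorem label_pow (H : CycleLabelling N n p x blk φ σ d) (j : ℕ) (z : Ω) :
    φ ((x ^ j) z) = φ z + ∑ i ∈ Finset.range j, (d ((σ ^ i) (blk z)) : ZMod 4) := by
  induction j with
  | zero => simp
  | succ j ih =>
    rw [pow_succ', Perm.mul_apply, H.label_apply, ih, H.blk_pow, Finset.sum_range_succ, add_assoc]

theorem label_zpow_self (H : CycleLabelling N n p x blk φ σ d) (i : ℤ) (z : Ω) :
    φ ((p ^ i) z) = φ z + i := by
  have hnat : ∀ (m : ℕ) (z : Ω), φ ((p ^ m) z) = φ z + m := by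
    intro m z
    induction m with
    | zero => simp
    | succ m ih => rw [pow_succ', Perm.mul_apply, H.label_self, ih]; push_cast; ring
  obtain ⟨m, rfl | rfl⟩ := i.eq_nat_or_neg
  · simpa using hnat m z
  · have := hnat m ((p ^ (-(m : ℤ))) z)
    rw [← Perm.mul_apply, ← zpow_natCast p m, ← zpow_add, add_neg_cancel, zpow_zero,
      Perm.one_apply] at this
    push_cast
    rw [this]
    ring

theorem zpow_blk_eq_iff (H : CycleLabelling N n p x blk φ σ d) (j : ℤ) (z w : Ω) :
    (σ ^ j) (blk z) = blk w ↔ ∃ i : ℤ, (p ^ i) ((x ^ j) z) = w := by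
  rw [← H.blk_zpow, eq_comm, H.blk_eq_iff]

theorem sameCycle_iff (H : CycleLabelling N n p x blk φ σ d) (z w : Ω) :
    σ.SameCycle (blk z) (blk w) ↔ ∃ i j : ℤ, (p ^ i * x ^ j) z = w := by
  simp only [Perm.SameCycle, H.zpow_blk_eq_iff, Perm.mul_apply]
  exact exists_comm

theorem minimalPeriod_dvd_iff (σ : Perm (Fin n)) (b : Fin n) (j : ℤ) :
    (minimalPeriod σ b : ℤ) ∣ j ↔ (σ ^ j) b = b :=
  (MulAction.zpow_smul_eq_iff_minimalPeriod_dvd (a := σ) (b := b) (n := j)).symm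

variable {blk' : Ω → Fin n} {φ' : Ω → ZMod 4} {τ : Perm (Fin n)} {e : Fin n → ℕ}

/-- On a common orbit of two commuting permutations with cycles of the same length `N`, where
`4 ∣ N`, the two induced permutations of cycles have the same length, and their total shifts
add up to twice this length. -/
theorem orbit (H : CycleLabelling N n p x blk φ σ d) (H' : CycleLabelling N n x p blk' φ' τ e)
    (hpx : Commute p x) (hN : 0 < N) (h4 : 4 ∣ N) (z : Ω) :
    minimalPeriod σ (blk z) = minimalPeriod τ (blk' z) ∧
      ∑ j ∈ Finset.range (minimalPeriod σ (blk z)), (d ((σ ^ j) (blk z)) : ZMod 4) +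
      ∑ j ∈ Finset.range (minimalPeriod τ (blk' z)), (e ((τ ^ j) (blk' z)) : ZMod 4) =
        2 * (minimalPeriod σ (blk z) : ZMod 4) := by
  set k := minimalPeriod σ (blk z) with hkdef
  set k' := minimalPeriod τ (blk' z) with hkdef'
  have hmulmem : ∀ (i j i' j' : ℤ),
      p ^ (i + i') * x ^ (j + j') = (p ^ i * x ^ j) * (p ^ i' * x ^ j') := by
    intro i j i' j'
    rw [zpow_add, zpow_add, mul_assoc, mul_assoc, ← mul_assoc (p ^ i'),
      ← mul_assoc (x ^ j), ((hpx.zpow_zpow i' j).eq)]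
  let L : AddSubgroup (ℤ × ℤ) :=
    { carrier := {ij | (p ^ ij.1 * x ^ ij.2) z = z}
      zero_mem' := by simp
      add_mem' := by
        rintro ⟨i, j⟩ ⟨i', j'⟩ h h'
        simp only [Set.mem_ofPred_eq, Prod.mk_add_mk] at h h' ⊢
        rw [hmulmem, Perm.mul_apply _ _ z, h', h]
      neg_mem' := by
        rintro ⟨i, j⟩ h
        simp only [Set.mem_ofPred_eq, Prod.neg_mk] at h ⊢
        have := hmulmem (-i) (-j) i j
        rw [neg_add_cancel, neg_add_cancel, zpow_zero, zpow_zero, mul_one] at this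
        have h2 := congrArg (fun θ : Perm Ω => θ z) this
        simp only [Perm.mul_apply _ (p ^ i * x ^ j) z, h, Perm.one_apply] at h2
        exact h2.symm }
  have hL : ∀ i j : ℤ, (i, j) ∈ L ↔ (p ^ i) ((x ^ j) z) = z := fun i j => Iff.rfl
  have hL' : ∀ i j : ℤ, (i, j) ∈ L ↔ (x ^ j) ((p ^ i) z) = z := fun i j => by
    rw [hL, ← Perm.mul_apply, (hpx.zpow_zpow i j).eq, Perm.mul_apply]
  have hk : ∀ j : ℤ, (k : ℤ) ∣ j ↔ ∃ i, (i, j) ∈ L := fun j => by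
    rw [minimalPeriod_dvd_iff, H.zpow_blk_eq_iff]
    rfl
  have hk' : ∀ i : ℤ, (k' : ℤ) ∣ i ↔ ∃ j, (i, j) ∈ L := fun i => by
    rw [minimalPeriod_dvd_iff, H'.zpow_blk_eq_iff]
    simp only [hL']
  obtain ⟨a, ha⟩ := (hk k).1 dvd_rfl
  obtain ⟨b, hb⟩ := (hk' k').1 dvd_rfl
  obtain ⟨hkk, hsum⟩ := relation_lattice_sum (N := N) (k := k) (k' := k') (a := -a) (b := -b)
    (by exact_mod_cast hN) (by exact_mod_cast h4) (by positivity) (by positivity) L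
    (fun i => by rw [hL]; simpa using H.zpow_apply_eq_iff i z)
    (fun j => by rw [hL]; simpa using H'.zpow_apply_eq_iff j z)
    (fun i j h => (hk j).2 ⟨i, h⟩) (fun i j h => (hk' i).2 ⟨j, h⟩)
    (by simpa using ha) (by simpa using hb)
  refine ⟨by exact_mod_cast hkk, ?_⟩
  have e1 := H.label_zpow_self a ((x ^ (k : ℤ)) z)
  rw [(hL _ _).1 ha, zpow_natCast, H.label_pow] at e1
  have e2 := H'.label_zpow_self b ((p ^ (k' : ℤ)) z)
  rw [(hL' _ _).1 hb, zpow_natCast, H'.label_pow] at e2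
  push_cast at hsum
  linear_combination hsum - e1 - e2

/-- For two commuting permutations with cycles of the same length `N`, where `4 ∣ N`, the
permutations which they induce on each other's cycles have the same sign. -/
theorem sign_eq_and_sum_eq (H : CycleLabelling N n p x blk φ σ d)
    (H' : CycleLabelling N n x p blk' φ' τ e)
    (hpx : Commute p x) (hN : 0 < N) (h4 : 4 ∣ N) :
    Perm.sign σ = Perm.sign τ ∧
      ((∑ i, d i + ∑ i, e i : ℕ) : ZMod 4) = 2 * (n : ZMod 4) := by
  classical
  have hsame : ∀ z w, σ.SameCycle (blk z) (blk w) ↔ τ.SameCycle (blk' z) (blk' w) := by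
    intro z w
    rw [H.sameCycle_iff, H'.sameCycle_iff, exists_comm]
    simp only [(hpx.zpow_zpow _ _).eq]
  let Q := Quotient (Perm.SameCycle.setoid σ)
  let f : Fin n → Q := fun i => Quotient.mk _ i
  have hf : ∀ i j, f i = f j ↔ σ.SameCycle i j := fun i j => Quotient.eq
  have hsurjQ : ∀ q : Q, ∃ z, f (blk z) = q := by
    intro q
    obtain ⟨i, rfl⟩ := Quotient.exists_rep q
    obtain ⟨z, rfl⟩ := H.surj i
    exact ⟨z, rfl⟩
  choose s hs using hsurjQ
  choose s' hs' using H'.surj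
  let f' : Fin n → Q := fun i => f (blk (s' i))
  have hf' : ∀ z, f' (blk' z) = f (blk z) := by
    intro z
    rw [hf, hsame, hs']
  constructor
  · refine sign_eq_of_cycle_matching (Q := Q) (fun q => blk (s q)) (fun q => blk' (s q))
      (fun i => ⟨f i, (hf _ _).1 (hs _)⟩) ?_ ?_ ?_
    · intro q q' h
      rw [← hs q, ← hs q']
      exact (hf _ _).2 h
    · intro q q' h
      rw [← hs q, ← hs q']
      exact (hf _ _).2 ((hsame _ _).2 h)
    · intro q j
      rw [← minimalPeriod_dvd_iff, ← minimalPeriod_dvd_iff, (H.orbit H' hpx hN h4 (s q)).1]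
  · have hfib : ∀ (q : Q) (c : Fin n → ZMod 4), ∑ i with f i = q, c i =
        ∑ j ∈ Finset.range (minimalPeriod σ (blk (s q))), c ((σ ^ j) (blk (s q))) := by
      intro q c
      rw [← sum_filter_sameCycle]
      refine Finset.sum_congr (Finset.filter_congr fun i _ => ?_) fun _ _ => rfl
      rw [← hf, hs, eq_comm]
    have hfib' : ∀ (q : Q) (c : Fin n → ZMod 4), ∑ i with f' i = q, c i =
        ∑ j ∈ Finset.range (minimalPeriod τ (blk' (s q))), c ((τ ^ j) (blk' (s q))) := by
      intro q c
      rw [← sum_filter_sameCycle]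
      refine Finset.sum_congr (Finset.filter_congr fun i _ => ?_) fun _ _ => rfl
      obtain ⟨z, rfl⟩ := H'.surj i
      rw [← hsame, ← hf, hs, hf', eq_comm]
    push_cast
    rw [← Finset.sum_fiberwise Finset.univ f, ← Finset.sum_fiberwise Finset.univ f',
      ← Finset.sum_add_distrib]
    have hn : 2 * (n : ZMod 4) = ∑ i : Fin n, 2 := by simp [mul_comm]
    rw [hn, ← Finset.sum_fiberwise Finset.univ f]
    refine Finset.sum_congr rfl fun q _ => ?_
    rw [hfib, hfib', hfib, (H.orbit H' hpx hN h4 (s q)).2]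
    simp [mul_comm]

theorem conj (H : CycleLabelling N n p x blk φ σ d) (h : Perm Ω) :
    CycleLabelling N n (h * p * h⁻¹) (h * x * h⁻¹) (fun z => blk (h⁻¹ z)) (fun z => φ (h⁻¹ z))
      σ d where
  surj := H.surj.comp h⁻¹.surjective
  blk_eq_iff w z := by
    rw [H.blk_eq_iff]
    refine exists_congr fun i => ?_
    rw [conj_zpow, Perm.mul_apply, Perm.mul_apply, Perm.eq_inv_iff_eq]
  zpow_apply_eq_iff i z := by
    rw [← H.zpow_apply_eq_iff i (h⁻¹ z), conj_zpow, Perm.mul_apply, Perm.mul_apply,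
      Perm.eq_inv_iff_eq]
  label_self z := by simpa using H.label_self (h⁻¹ z)
  blk_apply z := by simpa using H.blk_apply (h⁻¹ z)
  label_apply z := by simpa using H.label_apply (h⁻¹ z)

end CycleLabelling

/-- The character of a group of permutations preserving the blocks of `blk` is determined by
the induced permutations of the blocks and the shifts of the labels `φ`, if this holds on
generators. -/
theorem exists_blockPerm_and_shift {n : ℕ} {Ω : Type*} (blk : Ω → Fin n) (φ : Ω → ZMod 4)
    {ζ : ℂˣ} (hζ : ζ ^ 4 = 1) (ε : ℤˣ →* ℂˣ) {G : Subgroup (Perm Ω)} {S : Set (Perm Ω)}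
    (hG : G = Subgroup.closure S) (ρ : G →* ℂˣ)
    (hS : ∀ s ∈ S, ∀ h : s ∈ G, ∃ (σ : Perm (Fin n)) (d : Fin n → ℕ),
      (∀ z, blk (s z) = σ (blk z)) ∧ (∀ z, φ (s z) = φ z + d (blk z)) ∧
        ρ ⟨s, h⟩ = ζ ^ (∑ i, d i) * ε (Perm.sign σ))
    {s : Perm Ω} (h : s ∈ G) : ∃ (σ : Perm (Fin n)) (d : Fin n → ℕ),
      (∀ z, blk (s z) = σ (blk z)) ∧ (∀ z, φ (s z) = φ z + d (blk z)) ∧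
        ρ ⟨s, h⟩ = ζ ^ (∑ i, d i) * ε (Perm.sign σ) := by
  subst hG
  induction h using Subgroup.closure_induction with
  | mem s hs => exact hS s hs _
  | one => exact ⟨1, 0, by simp, by simp, by simpa only [Pi.zero_apply, Finset.sum_const_zero, pow_zero, Perm.sign_one,
    map_one, mul_one] using (rfl : ρ ⟨1, Subgroup.one_mem _⟩ = _).trans (map_one ρ)⟩
  | mul s t hs ht ihs iht =>
    obtain ⟨σ, d, h1, h2, h3⟩ := ihs
    obtain ⟨τ, e, k1, k2, k3⟩ := iht
    refine ⟨σ * τ, fun i => e i + d (τ i), ?_, ?_, ?_⟩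
    · intro z
      rw [Perm.mul_apply, Perm.mul_apply, h1, k1]
    · intro z
      rw [Perm.mul_apply, h2, k2, k1]
      push_cast
      ring
    · have : ρ ⟨s * t, Subgroup.mul_mem _ hs ht⟩ = ρ ⟨s, hs⟩ * ρ ⟨t, ht⟩ :=
        map_mul ρ ⟨s, hs⟩ ⟨t, ht⟩
      rw [this, h3, k3, Finset.sum_add_distrib, Equiv.sum_comp τ d, pow_add, Perm.sign_mul,
        map_mul, mul_comm (ζ ^ ∑ i, e i) (ζ ^ ∑ i, d i)]
      exact mul_mul_mul_comm _ _ _ _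
  | inv s hs ih =>
    obtain ⟨σ, d, h1, h2, h3⟩ := ih
    refine ⟨σ⁻¹, fun i => 3 * d (σ⁻¹ i), ?_, ?_, ?_⟩
    · intro z
      rw [Perm.eq_inv_iff_eq, ← h1, Perm.coe_inv, Equiv.apply_symm_apply]
    · intro z
      have h1' := h1 (s⁻¹ z)
      have h2' := h2 (s⁻¹ z)
      rw [Perm.coe_inv, Equiv.apply_symm_apply] at h1' h2'
      rw [h1', h2', Perm.coe_inv, Perm.coe_inv]
      simp only [Equiv.symm_apply_apply]
      have : (4 : ZMod 4) = 0 := rfl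
      push_cast
      linear_combination -(d (blk (s.symm z)) : ZMod 4) * this
    · have : ρ ⟨s⁻¹, Subgroup.inv_mem _ hs⟩ = (ρ ⟨s, hs⟩)⁻¹ := map_inv ρ ⟨s, hs⟩
      rw [this, h3, ← Finset.mul_sum, Equiv.sum_comp σ⁻¹ d, Perm.sign_inv, inv_eq_iff_mul_eq_one,
        mul_mul_mul_comm, ← pow_add, ← map_mul, Int.units_mul_self, map_one, mul_one,
        show ∑ i, d i + 3 * ∑ i, d i = 4 * ∑ i, d i by ring, pow_mul, hζ, one_pow]

theorem pow_eq_pow_of_zmod_four_eq {ζ : ℂˣ} (hζ : ζ ^ 4 = 1) {a b : ℕ}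
    (h : (a : ZMod 4) = b) : ζ ^ a = ζ ^ b := by
  rw [ZMod.natCast_eq_natCast_iff] at h
  rw [← pow_mod_orderOf, ← pow_mod_orderOf ζ b]
  exact congrArg _ (h.of_dvd (orderOf_dvd_of_pow_eq_one hζ))

section Blocks

variable {N n : ℕ}

/-- The block of size `N` which contains a point. -/
def blockOf (z : Fin (N * n)) : Fin n := ⟨z / N, Nat.div_lt_of_lt_mul z.2⟩

theorem pow_val_of_block_rotation {π : Perm (Fin (N * n))}
    (hπ : ∀ x, (π x : ℕ) = N * (x / N) + (x % N + 1) % N) (i : ℕ)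
    (z : Fin (N * n)) : ((π ^ i) z : ℕ) = N * (z / N) + (z % N + i) % N := by
  have hN : 0 < N := Nat.pos_of_mul_pos_right (z.1.zero_le.trans_lt z.2)
  induction i with
  | zero => simp [Nat.div_add_mod]
  | succ i ih =>
    rw [pow_succ', Perm.mul_apply, hπ, ih, Nat.mul_add_div hN,
      Nat.div_eq_of_lt (Nat.mod_lt _ hN), Nat.mul_add_mod, Nat.mod_mod, Nat.mod_add_mod,
      add_zero, add_assoc]

theorem cycleLabelling_of_block_rotation (hN : 0 < N) (h4 : 4 ∣ N) {π : Perm (Fin (N * n))}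
    (hπ : ∀ x, (π x : ℕ) = N * (x / N) + (x % N + 1) % N) {x : Perm (Fin (N * n))}
    {σ : Perm (Fin n)} {d : Fin n → ℕ} (hσ : ∀ z, blockOf (x z) = σ (blockOf z))
    (hd : ∀ z, ((x z : ℕ) : ZMod 4) = (z : ℕ) + d (blockOf z)) :
    CycleLabelling N n π x blockOf (fun z => ((z : ℕ) : ZMod 4)) σ d where
  surj i := ⟨⟨N * i, Nat.mul_lt_mul_of_pos_left i.2 hN⟩, by simp [blockOf, hN]⟩
  blk_eq_iff w z := by
    constructor
    · intro h
      have hdiv : (w : ℕ) / N = z / N := congrArg Fin.val h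
      refine ⟨(w % N + (N - z % N) : ℕ), Fin.ext ?_⟩
      have hz : (z : ℕ) % N < N := Nat.mod_lt _ hN
      rw [zpow_natCast, pow_val_of_block_rotation hπ, ← hdiv,
        show (z : ℕ) % N + (w % N + (N - z % N)) = w % N + N by omega, Nat.add_mod_right,
        Nat.mod_mod, Nat.div_add_mod]
    · rintro ⟨i, rfl⟩
      have hnat : ∀ (m : ℕ) (z : Fin (N * n)), blockOf ((π ^ m) z) = blockOf z := by
        intro m z
        refine Fin.ext ?_
        change ((π ^ m) z : ℕ) / N = z / N
        rw [pow_val_of_block_rotation hπ, Nat.mul_add_div hN, Nat.div_eq_of_lt (Nat.mod_lt _ hN),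
          add_zero]
      obtain ⟨m, rfl | rfl⟩ := i.eq_nat_or_neg
      · rw [zpow_natCast, hnat]
      · rw [← hnat m ((π ^ (-(m : ℤ))) z), ← zpow_natCast, ← Perm.mul_apply, ← zpow_add,
          add_neg_cancel, zpow_zero, Perm.one_apply]
  zpow_apply_eq_iff i z := by
    have hnat : ∀ m : ℕ, (π ^ m) z = z ↔ N ∣ m := by
      intro m
      rw [Fin.ext_iff, pow_val_of_block_rotation hπ]
      conv_lhs => rhs; rw [← Nat.div_add_mod (z : ℕ) N]
      rw [Nat.add_left_cancel_iff, Nat.mod_add_mod]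
      exact Nat.add_modEq_left_iff
    obtain ⟨m, rfl | rfl⟩ := i.eq_nat_or_neg
    · rw [zpow_natCast, hnat, Int.natCast_dvd_natCast]
    · rw [zpow_neg, zpow_natCast, Perm.inv_eq_iff_eq, eq_comm, hnat, dvd_neg,
        Int.natCast_dvd_natCast]
  label_self z := by
    have h : (π z : ℕ) ≡ z + 1 [MOD N] := by
      rw [hπ]
      simp [Nat.ModEq, Nat.add_mod]
    simpa using (ZMod.natCast_eq_natCast_iff _ _ 4).2 (h.of_dvd h4)
  blk_apply := hσ
  label_apply := hd

theorem blockOf_and_label_of_rotation (hN : 0 < N) (h4 : 4 ∣ N) {a : Perm (Fin (N * n))}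
    (j : Fin n) (ha : ∀ x, (a x : ℕ) =
      if (x : ℕ) / N = j then N * j + ((x : ℕ) % N + 1) % N else (x : ℕ)) (z : Fin (N * n)) :
    blockOf (a z) = blockOf z ∧
      ((a z : ℕ) : ZMod 4) = (z : ℕ) + (Pi.single j 1 : Fin n → ℕ) (blockOf z) := by
  by_cases h : (z : ℕ) / N = j
  · have haz := ha z
    rw [if_pos h] at haz
    have hblk : blockOf z = j := Fin.ext h
    constructor
    · refine Fin.ext ?_
      change (a z : ℕ) / N = z / N
      rw [haz, Nat.mul_add_div hN, Nat.div_eq_of_lt (Nat.mod_lt _ hN), h, add_zero]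
    · have h' : (a z : ℕ) ≡ z + 1 [MOD N] := by
        rw [haz]
        simp [Nat.ModEq, Nat.add_mod]
      rw [hblk, Pi.single_eq_same]
      simpa using (ZMod.natCast_eq_natCast_iff _ _ 4).2 (h'.of_dvd h4)
  · have haz := ha z
    rw [if_neg h] at haz
    have hblk : blockOf z ≠ j := fun hj => h (congrArg Fin.val hj)
    rw [Fin.ext haz, Pi.single_eq_of_ne hblk]
    simp

theorem blockOf_and_label_of_swap (hN : 0 < N) (h4 : 4 ∣ N) {b : Perm (Fin (N * n))} {i : ℕ}
    (hi : i + 1 < n) (hb : ∀ x, (b x : ℕ) = if (x : ℕ) / N = i then (x : ℕ) + N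
      else if (x : ℕ) / N = i + 1 then (x : ℕ) - N else (x : ℕ)) (z : Fin (N * n)) :
    blockOf (b z) = swap ⟨i, by omega⟩ ⟨i + 1, hi⟩ (blockOf z) ∧
      ((b z : ℕ) : ZMod 4) = (z : ℕ) := by
  have hbz := hb z
  have hN4 : (N : ZMod 4) = 0 := (ZMod.natCast_eq_zero_iff N 4).2 h4
  split_ifs at hbz with h h'
  · have hblk : blockOf z = ⟨i, by omega⟩ := Fin.ext h
    constructor
    · rw [hblk, swap_apply_left]
      refine Fin.ext ?_
      change (b z : ℕ) / N = i + 1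
      rw [hbz, Nat.add_div_right _ hN, h]
    · simp [hbz, hN4]
  · have hblk : blockOf z = ⟨i + 1, hi⟩ := Fin.ext h'
    have hle : N ≤ z := by
      by_contra hlt
      rw [Nat.div_eq_of_lt (not_le.1 hlt)] at h'
      omega
    constructor
    · rw [hblk, swap_apply_right]
      refine Fin.ext ?_
      change (b z : ℕ) / N = i
      rw [hbz, ← Nat.add_left_inj (n := 1), ← Nat.add_div_right _ hN, Nat.sub_add_cancel hle, h']
    · rw [hbz, Nat.cast_sub hle, hN4, sub_zero]
  · have hne : blockOf z ≠ ⟨i, by omega⟩ := fun hj => h (congrArg Fin.val hj)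
    have hne' : blockOf z ≠ ⟨i + 1, hi⟩ := fun hj => h' (congrArg Fin.val hj)
    rw [swap_apply_of_ne_of_ne hne hne', Fin.ext hbz]
    simp

end Blocks

theorem exists_signHom_apply_neg_one {μ : ℂˣ} (hμ : μ = 1 ∨ μ = -1) :
    ∃ ε : ℤˣ →* ℂˣ, ε (-1) = μ := by
  obtain rfl | rfl := hμ
  · exact ⟨1, rfl⟩
  · exact ⟨Units.map (Int.castRingHom ℂ : ℤ →* ℂ), by ext; simp⟩



/-- Let `r ≥ 2` be even, `n ≥ 2`.  In `S_{2rn}` (on `Fin (2*r*n)`,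
`0`-indexed), for `0 ≤ j < n` let `A j` be the `2r`-cycle on the `j`-th block of size
`2r`, `π = A_0 ⋯ A_{n-1}`, and for `0 ≤ i < n-1` let `B i` swap blocks `i` and `i+1`
position-by-position, so that the centralizer of `π` is generated by the `A j`'s and
`B i`'s.  Let `ζ ∈ {i, -1, -i}`, `μ ∈ {1,-1}`, and let `ρ` be a homomorphism from the
centralizer of `π` to `ℂˣ` with `ρ(A j) = ζ`, `ρ(B i) = μ`, and `ρ(π) = -1`.  Then for all commuting
`t, t'` in the conjugacy class of `π` and all `g, g'` with `g π g⁻¹ = t`,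
`g' π g'⁻¹ = t'`, the elements `g'⁻¹ t g'` and `g⁻¹ t' g` lie in the centralizer of
`π`, `ρ(g⁻¹ t g) = -1` and `ρ(g'⁻¹ t g') · ρ(g⁻¹ t' g) = 1`: for `r` even and
`ρ = χ_{c,…,c} ⊗ μ` with `c ∈ {r/2, r, 3r/2}` and `ρ(π) = -1`, the braiding is
negative. -/
theorem stmt13 (r n : ℕ) (hr : 2 ≤ r) (hreven : Even r) (hn : 2 ≤ n)
    (A : ℕ → Equiv.Perm (Fin (2 * r * n)))
    (hA : ∀ j < n, ∀ x : Fin (2 * r * n),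
      ((A j x : ℕ)) = if (x : ℕ) / (2 * r) = j
        then 2 * r * j + ((x : ℕ) % (2 * r) + 1) % (2 * r) else (x : ℕ))
    (π : Equiv.Perm (Fin (2 * r * n)))
    (hπ : ∀ x : Fin (2 * r * n),
      ((π x : ℕ)) = 2 * r * ((x : ℕ) / (2 * r)) + ((x : ℕ) % (2 * r) + 1) % (2 * r))
    (B : ℕ → Equiv.Perm (Fin (2 * r * n)))
    (hB : ∀ i, i + 1 < n → ∀ x : Fin (2 * r * n),
      ((B i x : ℕ)) = if (x : ℕ) / (2 * r) = i then (x : ℕ) + 2 * r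
        else if (x : ℕ) / (2 * r) = i + 1 then (x : ℕ) - 2 * r else (x : ℕ))
    (hgen : Subgroup.centralizer {π} =
      Subgroup.closure (A '' {j | j < n} ∪ B '' {i | i + 1 < n}))
    (ζ : ℂˣ) (hζ : (ζ : ℂ) = Complex.I ∨ (ζ : ℂ) = -1 ∨ (ζ : ℂ) = -Complex.I)
    (μ : ℂˣ) (hμ : μ = 1 ∨ μ = -1)
    (ρ : ↥(Subgroup.centralizer {π}) →* ℂˣ)
    (hρA : ∀ j (_ : j < n) (h : A j ∈ Subgroup.centralizer {π}), ρ ⟨A j, h⟩ = ζ)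
    (hρB : ∀ i (_ : i + 1 < n) (h : B i ∈ Subgroup.centralizer {π}), ρ ⟨B i, h⟩ = μ)
    (hρπ : ∀ h : π ∈ Subgroup.centralizer {π}, ρ ⟨π, h⟩ = -1)
    (t t' : Equiv.Perm (Fin (2 * r * n))) (hcomm : t * t' = t' * t)
    (g g' : Equiv.Perm (Fin (2 * r * n))) (hg : g * π * g⁻¹ = t) (hg' : g' * π * g'⁻¹ = t') :
    g'⁻¹ * t * g' ∈ Subgroup.centralizer {π} ∧
    g⁻¹ * t' * g ∈ Subgroup.centralizer {π} ∧
    (∀ h : g⁻¹ * t * g ∈ Subgroup.centralizer {π}, ρ ⟨g⁻¹ * t * g, h⟩ = -1) ∧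
    (∀ (h1 : g'⁻¹ * t * g' ∈ Subgroup.centralizer {π})
       (h2 : g⁻¹ * t' * g ∈ Subgroup.centralizer {π}),
      ρ ⟨g'⁻¹ * t * g', h1⟩ * ρ ⟨g⁻¹ * t' * g, h2⟩ = 1) := by
  have hN : 0 < 2 * r := by omega
  have h4 : 4 ∣ 2 * r := by
    obtain ⟨m, rfl⟩ := hreven
    exact ⟨m, by ring⟩
  have hζ4 : ζ ^ 4 = 1 := by
    refine Units.ext ?_
    rw [Units.val_pow_eq_pow_val, Units.val_one]
    obtain h | h | h := hζ <;> rw [h]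
    · exact Complex.I_pow_four
    · norm_num
    · rw [Even.neg_pow (by decide), Complex.I_pow_four]
  obtain ⟨ε, hε⟩ := exists_signHom_apply_neg_one hμ
  have hchar : ∀ s (h : s ∈ Subgroup.centralizer {π}), ∃ (σ : Perm (Fin n)) (d : Fin n → ℕ),
      (∀ z, blockOf (s z) = σ (blockOf z)) ∧
        (∀ z, ((s z : ℕ) : ZMod 4) = (z : ℕ) + d (blockOf z)) ∧
        ρ ⟨s, h⟩ = ζ ^ (∑ i, d i) * ε (Perm.sign σ) := by
    intro s h
    refine exists_blockPerm_and_shift blockOf (fun z => ((z : ℕ) : ZMod 4)) hζ4 ε hgen ρ ?_ h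
    rintro _ (⟨j, hj, rfl⟩ | ⟨i, hi, rfl⟩) h
    · have hrot := blockOf_and_label_of_rotation hN h4 ⟨j, hj⟩ (hA j hj)
      refine ⟨1, Pi.single ⟨j, hj⟩ 1, fun z => (hrot z).1, fun z => (hrot z).2, ?_⟩
      rw [hρA j hj, Finset.sum_pi_single']
      simp
    · have hswap := blockOf_and_label_of_swap hN h4 hi (hB i hi)
      refine ⟨swap ⟨i, Nat.lt_of_succ_lt hi⟩ ⟨i + 1, hi⟩, 0, fun z => (hswap z).1,
        fun z => by simpa using (hswap z).2, ?_⟩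
      rw [hρB i hi, Perm.sign_swap (by simp), hε]
      simp
  have hlab : ∀ {x : Perm (Fin (2 * r * n))} {σ : Perm (Fin n)} {d : Fin n → ℕ},
      (∀ z, blockOf (x z) = σ (blockOf z)) →
      (∀ z, ((x z : ℕ) : ZMod 4) = (z : ℕ) + d (blockOf z)) →
      CycleLabelling (2 * r) n π x blockOf (fun z => ((z : ℕ) : ZMod 4)) σ d :=
    fun hσ hd => cycleLabelling_of_block_rotation hN h4 hπ hσ hd
  have hmem : ∀ h u : Perm (Fin (2 * r * n)), h * π * h⁻¹ * u = u * (h * π * h⁻¹) →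
      h⁻¹ * u * h ∈ Subgroup.centralizer {π} := by
    intro h u hu
    rw [Subgroup.mem_centralizer_singleton_iff]
    have := congrArg (fun v => h⁻¹ * v * h) hu
    simp only [mul_assoc, inv_mul_cancel_left, inv_mul_cancel, mul_one] at this ⊢
    exact this.symm
  have hζn : (ζ ^ n) ^ 2 = 1 := by
    have hπmem : π ∈ Subgroup.centralizer {π} := Subgroup.mem_centralizer_singleton_iff.2 rfl
    obtain ⟨σ, d, hσ, hd, hρ⟩ := hchar π hπmem
    have H := hlab hσ hd
    have hσ1 : σ = 1 := by
      ext1 i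
      obtain ⟨z, rfl⟩ := H.surj i
      rw [← hσ, Perm.one_apply, H.blk_eq_iff]
      exact ⟨1, rfl⟩
    have hd1 : ∀ i, (d i : ZMod 4) = 1 := by
      intro i
      obtain ⟨z, rfl⟩ := H.surj i
      exact add_left_cancel ((hd z).symm.trans (H.label_self z))
    have hsum : ((∑ i, d i : ℕ) : ZMod 4) = (n : ℕ) := by
      simp [hd1]
    rw [hρπ, hσ1, pow_eq_pow_of_zmod_four_eq hζ4 hsum, Perm.sign_one, map_one, mul_one] at hρ
    rw [← hρ]
    exact neg_one_sq
  refine ⟨hmem g' t (by rw [hg', hcomm]), hmem g t' (by rw [hg, hcomm]), ?_, ?_⟩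
  · intro h
    have ht : g⁻¹ * t * g = π := by rw [← hg]; group
    simp only [ht]
    exact hρπ _
  · intro h1 h2
    obtain ⟨τ, e, hτ, he, hρ1⟩ := hchar _ h1
    obtain ⟨σ, d, hσ, hd, hρ2⟩ := hchar _ h2
    have H := (hlab hσ hd).conj g
    have H' := (hlab hτ he).conj g'
    rw [hg, show g * (g⁻¹ * t' * g) * g⁻¹ = t' by group] at H
    rw [hg', show g' * (g'⁻¹ * t * g') * g'⁻¹ = t by group] at H'
    obtain ⟨hsign, hsum⟩ := H.sign_eq_and_sum_eq H' hcomm hN h4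
    rw [hρ1, hρ2, hsign, mul_mul_mul_comm, ← map_mul, Int.units_mul_self, map_one, mul_one,
      ← pow_add, add_comm,
      pow_eq_pow_of_zmod_four_eq hζ4 (b := n * 2) (by rw [hsum]; push_cast; ring), pow_mul, hζn]
end
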